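/- arXiv:2006.03414 — 2 statements merged into one kernel-verified Lean document; each statement's English description precedes it below -/
import Mathlib

section
/- Let d, m ≥ 1 be integers and let P : U(d)^m → ℂ be a function that arises from evaluating a polynomial (with complex coefficients) in the 2md² real variables given by the real and imaginary parts of the entries of the m matrices. If P is not identically zero on U(d)^m, then the set Z = {(U₁,…,U_m) ∈ U(d)^m : P(U₁,…,U_m) = 0} is a null set with respect to the normalized Haar measure on the compact group U(d)^m. -/
open MeasureTheory Matrix

noncomputable section

/-- The Borel σ-algebra on the unitary group `U(d)` (a compact topological group). -/
instance unitaryGroupMeasurableSpace (d : ℕ) :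
    MeasurableSpace (Matrix.unitaryGroup (Fin d) ℂ) := borel _

instance unitaryGroupBorelSpace (d : ℕ) :
    BorelSpace (Matrix.unitaryGroup (Fin d) ℂ) := ⟨rfl⟩

/-- The zero set of a real-analytic function on a finite-dimensional real vector space which is not
identically zero is a null set. -/
theorem AnalyticOnNhd.measure_zeros_eq_zero {E F : Type*} [NormedAddCommGroup E] [NormedSpace ℝ E]
    [FiniteDimensional ℝ E] [MeasurableSpace E] [BorelSpace E] [NormedAddCommGroup F]
    [NormedSpace ℝ F] (ν : Measure E) [ν.IsAddHaarMeasure] {f : E → F}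
    (hf : AnalyticOnNhd ℝ f Set.univ) {x₀ : E} (hx₀ : f x₀ ≠ 0) : ν {x | f x = 0} = 0 := by
  have hcont : Continuous f := continuousOn_univ.mp hf.continuousOn
  have hmeas : MeasurableSet {q : ℝ × E | f (x₀ + q.1 • q.2) = 0} :=
    (isClosed_eq (by fun_prop) continuous_const).measurableSet
  have hline (y : E) : volume {s : ℝ | f (x₀ + s • y) = 0} = 0 := by
    have han : AnalyticOnNhd ℝ (fun s : ℝ => f (x₀ + s • y)) Set.univ := fun s _ =>
      (hf (x₀ + s • y) trivial).comp (f := fun s : ℝ => x₀ + s • y) (by fun_prop)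
    rcases han.eqOn_zero_or_eventually_ne_zero_of_preconnected isPreconnected_univ with h | h
    · exact absurd (by simpa using h (Set.mem_univ 0)) hx₀
    · have hae := ae_restrict_le_codiscreteWithin (μ := volume) MeasurableSet.univ h
      rw [Measure.restrict_univ] at hae
      simpa [Set.compl_ofPred] using mem_ae_iff.1 hae
  have hprod : (volume.prod ν) {q : ℝ × E | f (x₀ + q.1 • q.2) = 0} = 0 := by
    rw [Measure.prod_apply_symm hmeas]
    simpa using lintegral_eq_zero_of_ae_eq_zero (.of_forall hline)
  obtain ⟨s, hs, hs0⟩ := ((Measure.measure_ae_null_of_prod_null hprod).and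
    (Measure.ae_ne volume (0 : ℝ))).exists
  have hscale : ν ((s • ·) ⁻¹' ((x₀ + ·) ⁻¹' {x | f x = 0})) = 0 := hs
  rw [Measure.addHaar_preimage_smul ν hs0, measure_preimage_add, mul_eq_zero] at hscale
  exact hscale.resolve_left (by simp [hs0])

theorem AnalyticAt.matrix_det {n E : Type*} [Fintype n] [DecidableEq n] [NormedAddCommGroup E]
    [NormedSpace ℝ E] {M : E → Matrix n n ℂ} {x : E} (hM : ∀ i j, AnalyticAt ℝ (M · i j) x) :
    AnalyticAt ℝ (fun y => (M y).det) x := by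
  simp only [det_apply']
  exact Finset.analyticAt_fun_sum _ fun σ _ =>
    analyticAt_const.mul (Finset.analyticAt_fun_prod _ fun i _ => hM (σ i) i)

theorem AnalyticAt.matrix_inv_apply {n E : Type*} [Fintype n] [DecidableEq n]
    [NormedAddCommGroup E] [NormedSpace ℝ E] {M : E → Matrix n n ℂ} {x : E}
    (hM : ∀ i j, AnalyticAt ℝ (M · i j) x) (hx : IsUnit (M x)) (i j : n) :
    AnalyticAt ℝ (fun y => (M y)⁻¹ i j) x := by
  simp only [inv_def, Matrix.smul_apply, smul_eq_mul, Ring.inverse_eq_inv', adjugate_apply]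
  refine ((matrix_det hM).inv ((isUnit_iff_isUnit_det _).1 hx).ne_zero).mul
    (matrix_det fun k l => ?_)
  simp only [updateRow_apply]
  split_ifs
  · exact analyticAt_const
  · exact hM k l

namespace Matrix

variable {n : Type*} [Fintype n] [DecidableEq n]

/-- The Cayley transform `(1 + K) (1 - K)⁻¹` of a square matrix `K`. -/
def cayley (K : Matrix n n ℂ) : Matrix n n ℂ := (1 + K) * (1 - K)⁻¹

open scoped ComplexOrder in
theorem isUnit_one_sub_of_conjTranspose_eq_neg {K : Matrix n n ℂ} (hK : Kᴴ = -K) :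
    IsUnit (1 - K) := by
  have hpos : ((1 : Matrix n n ℂ) + Kᴴ * K).PosDef :=
    PosDef.one.add_posSemidef (posSemidef_conjTranspose_mul_self K)
  have hfac : (1 : Matrix n n ℂ) + Kᴴ * K = (1 + K) * (1 - K) := by
    rw [hK]; noncomm_ring
  have hunit := hpos.isUnit
  rw [hfac] at hunit
  exact isUnit_of_mul_isUnit_right hunit

theorem cayley_mem_unitaryGroup {K : Matrix n n ℂ} (hK : Kᴴ = -K) :
    cayley K ∈ unitaryGroup n ℂ := by
  have hsub := (isUnit_iff_isUnit_det _).1 (isUnit_one_sub_of_conjTranspose_eq_neg hK)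
  have hadd : IsUnit (1 + K).det := by
    simpa using (isUnit_iff_isUnit_det _).1
      (isUnit_one_sub_of_conjTranspose_eq_neg (K := -K) (by simp [hK]))
  have hcomm : (1 - K) * (1 + K) = (1 + K) * (1 - K) := by noncomm_ring
  rw [mem_unitaryGroup_iff', star_eq_conjTranspose, cayley, conjTranspose_mul,
    conjTranspose_nonsing_inv]
  simp only [conjTranspose_add, conjTranspose_sub, conjTranspose_one, hK, sub_neg_eq_add,
    ← sub_eq_add_neg]
  rw [Matrix.mul_assoc, ← Matrix.mul_assoc (1 - K), hcomm, Matrix.mul_assoc,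
    mul_nonsing_inv _ hsub, Matrix.mul_one, nonsing_inv_mul _ hadd]

/-- A unitary matrix without eigenvalue `-1` is the Cayley transform of a skew-Hermitian matrix. -/
theorem exists_cayley_eq {w : Matrix n n ℂ} (hw : w ∈ unitaryGroup n ℂ) (hu : IsUnit (1 + w)) :
    ∃ K : Matrix n n ℂ, Kᴴ = -K ∧ cayley K = w := by
  have hdet := (isUnit_iff_isUnit_det _).1 hu
  have hww : wᴴ * w = 1 := mem_unitaryGroup_iff'.1 hw
  set V := (1 + w)⁻¹
  have hV : (1 + w) * V = 1 := mul_nonsing_inv _ hdet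
  have hVstar : Vᴴ = w * V := by
    have h1 : Vᴴ * (1 + wᴴ) = 1 := by simpa using congrArg conjTranspose hV
    have h2 : (1 + wᴴ) * (w * V) = 1 := by
      rw [← Matrix.mul_assoc, Matrix.add_mul, hww, Matrix.one_mul, add_comm, hV]
    exact left_inv_eq_right_inv h1 h2
  have hwV : w * V = 1 - V := by
    rw [eq_sub_iff_add_eq', ← hV, Matrix.add_mul, Matrix.one_mul]
  have hsub : 1 - (1 - (2 : ℂ) • V) = (2 : ℂ) • V := by abel
  have hadd : 1 + (1 - (2 : ℂ) • V) = w * ((2 : ℂ) • V) := by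
    rw [Matrix.mul_smul, hwV, smul_sub, two_smul ℂ (1 : Matrix n n ℂ)]; abel
  refine ⟨1 - (2 : ℂ) • V, ?_, ?_⟩
  · simp only [conjTranspose_sub, conjTranspose_one, conjTranspose_smul, hVstar, hwV, star_ofNat,
      smul_sub, two_smul ℂ (1 : Matrix n n ℂ)]
    abel
  · rw [cayley, hsub, hadd, mul_nonsing_inv_cancel_right]
    rw [det_smul]
    exact (IsUnit.mk0 _ (by simp)).mul (isUnit_nonsing_inv_det _ hdet)

open scoped Topology in
theorem eventually_isUnit_one_add_exp_smul (w : Matrix n n ℂ) :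
    ∀ᶠ θ : ℝ in 𝓝[≠] 0, IsUnit (1 + Complex.exp (θ * Complex.I) • w) := by
  have hderiv : HasDerivAt (fun θ : ℝ => -Complex.exp (-(θ * Complex.I))) Complex.I 0 := by
    simpa using (((hasDerivAt_id (0 : ℝ)).ofReal_comp.mul_const Complex.I).fun_neg.cexp).fun_neg
  have hfin : ∀ᶠ a in 𝓝[≠] (-Complex.exp (-((0 : ℝ) * Complex.I))), a ∉ spectrum ℂ w := by
    filter_upwards [mem_nhdsWithin_of_mem_nhds
      ((w.finite_spectrum.subset Set.sdiff_subset).isClosed.isOpen_compl.mem_nhds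
        (Set.notMem_sdiff_of_mem (Set.mem_singleton _))), self_mem_nhdsWithin] with a ha hne hmem
    exact ha ⟨hmem, hne⟩
  filter_upwards [(hderiv.tendsto_nhdsNE Complex.I_ne_zero).eventually hfin] with θ hθ
  have hmul : Complex.exp (θ * Complex.I) * Complex.exp (-(θ * Complex.I)) = 1 := by
    rw [← Complex.exp_add]; simp
  have heq : 1 + Complex.exp (θ * Complex.I) • w = (-Complex.exp (θ * Complex.I)) •
      (algebraMap ℂ (Matrix n n ℂ) (-Complex.exp (-(θ * Complex.I))) - w) := by
    rw [Algebra.algebraMap_eq_smul_one, smul_sub, smul_smul, neg_mul_neg, hmul, one_smul,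
      neg_smul, sub_neg_eq_add]
  rw [heq]
  exact (spectrum.notMem_iff.1 hθ).smul (Units.mk0 _ (neg_ne_zero.2 (Complex.exp_ne_zero _)))

/-- The Cayley transforms of the skew-Hermitian parts of a family of square matrices. -/
def cayleyUnitary {ι : Type*} (x : ι → n → n → ℂ) (l : ι) : unitaryGroup n ℂ :=
  ⟨cayley (of (x l) - (of (x l))ᴴ), cayley_mem_unitaryGroup (by simp)⟩

theorem analyticAt_cayleyUnitary_apply {ι : Type*} [Fintype ι] (x : ι → n → n → ℂ) (l : ι)
    (i j : n) : AnalyticAt ℝ (fun y => (cayleyUnitary y l : Matrix n n ℂ) i j) x := by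
  have hcoord (i j : n) : AnalyticAt ℝ (fun y : ι → n → n → ℂ => y l i j) x :=
    ((ContinuousLinearMap.proj (R := ℝ) (φ := fun _ : n => ℂ) j).comp
      ((ContinuousLinearMap.proj (φ := fun _ : n => n → ℂ) i).comp
        (ContinuousLinearMap.proj (φ := fun _ : ι => n → n → ℂ) l))).analyticAt x
  have hskew (i j : n) :
      AnalyticAt ℝ (fun y : ι → n → n → ℂ => (of (y l) - (of (y l))ᴴ) i j) x :=
    (hcoord i j).sub ((Complex.conjCLE.toContinuousLinearMap.analyticAt _).comp (hcoord j i))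
  have hinv := AnalyticAt.matrix_inv_apply
    (M := fun y : ι → n → n → ℂ => 1 - (of (y l) - (of (y l))ᴴ))
    (fun i j => analyticAt_const.sub (hskew i j))
    (isUnit_one_sub_of_conjTranspose_eq_neg (by simp))
  simp only [cayleyUnitary, cayley, mul_apply]
  exact Finset.analyticAt_fun_sum _ fun k _ => (analyticAt_const.add (hskew i k)).mul (hinv k j)

theorem continuous_cayleyUnitary {ι : Type*} [Fintype ι] :
    Continuous (cayleyUnitary : (ι → n → n → ℂ) → ι → unitaryGroup n ℂ) :=
  continuous_pi fun l => Continuous.subtype_mk (continuous_matrix fun i j =>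
    continuous_iff_continuousAt.2 fun x => (analyticAt_cayleyUnitary_apply x l i j).continuousAt) _

theorem mem_range_cayleyUnitary {ι : Type*} {w : ι → unitaryGroup n ℂ}
    (hw : ∀ l, IsUnit (1 + (w l : Matrix n n ℂ))) :
    w ∈ Set.range (cayleyUnitary : (ι → n → n → ℂ) → ι → unitaryGroup n ℂ) := by
  choose K hK hcay using fun l => exists_cayley_eq (w l).2 (hw l)
  refine ⟨fun l => (2⁻¹ : ℂ) • K l, funext fun l => Subtype.ext ?_⟩
  have hhalf : (2⁻¹ : ℂ) • K l - ((2⁻¹ : ℂ) • K l)ᴴ = K l := by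
    rw [conjTranspose_smul, hK]
    ext i j
    simp
    ring
  change cayley ((2⁻¹ : ℂ) • K l - ((2⁻¹ : ℂ) • K l)ᴴ) = _
  rw [hhalf, hcay]

theorem denseRange_cayleyUnitary {ι : Type*} [Finite ι] :
    DenseRange (cayleyUnitary : (ι → n → n → ℂ) → ι → unitaryGroup n ℂ) := by
  intro w
  have hmem (θ : ℝ) (l : ι) :
      Complex.exp (θ * Complex.I) • (w l : Matrix n n ℂ) ∈ unitaryGroup n ℂ := by
    rw [mem_unitaryGroup_iff, star_smul, smul_mul_smul_comm, mem_unitaryGroup_iff.1 (w l).2,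
      Complex.star_def, ← Complex.exp_conj, ← Complex.exp_add]
    simp
  let γ : ℝ → ι → unitaryGroup n ℂ := fun θ l => ⟨_, hmem θ l⟩
  have hγ : Continuous γ := continuous_pi fun l => Continuous.subtype_mk (by fun_prop) _
  have hγ0 : γ 0 = w := funext fun l => Subtype.ext (by simp [γ])
  refine mem_closure_of_tendsto
    (hγ0 ▸ hγ.continuousAt.tendsto.mono_left (nhdsWithin_le_nhds (s := {0}ᶜ))) ?_
  filter_upwards [Filter.eventually_all.2 fun l => eventually_isUnit_one_add_exp_smul (w l).1]
    with θ hθ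
  exact mem_range_cayleyUnitary hθ

end Matrix

theorem MvPolynomial.analyticAt_eval_re_im {ι n E : Type*} [NormedAddCommGroup E]
    [NormedSpace ℝ E] {M : E → ι → Matrix n n ℂ} {x : E}
    (hM : ∀ l i j, AnalyticAt ℝ (M · l i j) x) (p : MvPolynomial (ι × n × n × Bool) ℂ) :
    AnalyticAt ℝ (fun y => MvPolynomial.eval
      (fun v : ι × n × n × Bool => if v.2.2.2 then ((M y v.1 v.2.1 v.2.2.1).re : ℂ)
        else ((M y v.1 v.2.1 v.2.2.1).im : ℂ)) p) x := by
  simp only [← MvPolynomial.coe_aeval_eq_eval]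
  refine AnalyticAt.aeval_mvPolynomial (fun v => ?_) p
  split_ifs
  · exact ((Complex.ofRealCLM.comp Complex.reCLM).analyticAt _).comp (hM v.1 v.2.1 v.2.2.1)
  · exact ((Complex.ofRealCLM.comp Complex.imCLM).analyticAt _).comp (hM v.1 v.2.1 v.2.2.1)

instance Matrix.unitaryGroupSecondCountable (d : ℕ) :
    SecondCountableTopology (unitaryGroup (Fin d) ℂ) :=
  haveI : SecondCountableTopology (Matrix (Fin d) (Fin d) ℂ) :=
    inferInstanceAs (SecondCountableTopology (Fin d → Fin d → ℂ))
  TopologicalSpace.Subtype.secondCountableTopology _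

/-- If a function `P : U(d)^m → ℂ` arises from evaluating a polynomial (with complex
coefficients) in the `2md²` real variables given by the real and imaginary parts of the
matrix entries, and `P` is not identically zero, then its zero set is a null set with
respect to the normalized Haar measure on the compact group `U(d)^m`. -/
theorem zero_set_of_polynomial_haar_null (d m : ℕ) (hd : 1 ≤ d) (hm : 1 ≤ m)
    (P : (Fin m → Matrix.unitaryGroup (Fin d) ℂ) → ℂ)
    (hP : ∃ p : MvPolynomial (Fin m × Fin d × Fin d × Bool) ℂ,
      ∀ Us : Fin m → Matrix.unitaryGroup (Fin d) ℂ,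
        P Us = MvPolynomial.eval
          (fun v : Fin m × Fin d × Fin d × Bool =>
            if v.2.2.2 then
              (((Us v.1 : Matrix (Fin d) (Fin d) ℂ) v.2.1 v.2.2.1).re : ℂ)
            else
              (((Us v.1 : Matrix (Fin d) (Fin d) ℂ) v.2.1 v.2.2.1).im : ℂ)) p)
    (hP0 : ∃ Us, P Us ≠ 0)
    (μ : Measure (Fin m → Matrix.unitaryGroup (Fin d) ℂ))
    (hHaar : μ.IsHaarMeasure) (hProb : IsProbabilityMeasure μ) :
    μ {Us | P Us = 0} = 0 := by
  obtain ⟨p, hp⟩ := hP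
  obtain ⟨h, hh⟩ := hP0
  have hPcont : Continuous P := by
    rw [funext hp]
    refine (MvPolynomial.continuous_eval p).comp (continuous_pi fun v => ?_)
    have hentry : Continuous fun Us : Fin m → Matrix.unitaryGroup (Fin d) ℂ =>
        (Us v.1 : Matrix (Fin d) (Fin d) ℂ) v.2.1 v.2.2.1 :=
      (continuous_subtype_val.comp (continuous_apply v.1)).matrix_elem _ _
    split_ifs
    · exact Complex.continuous_ofReal.comp (Complex.continuous_re.comp hentry)
    · exact Complex.continuous_ofReal.comp (Complex.continuous_im.comp hentry)
  let Φ : (Fin m → Fin d → Fin d → ℂ) → Fin m → Matrix.unitaryGroup (Fin d) ℂ := cayleyUnitary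
  have hΦ : Continuous Φ := continuous_cayleyUnitary
  let ν : Measure (Fin m → Fin d → Fin d → ℂ) := Measure.addHaar
  have hslice (g : Fin m → Matrix.unitaryGroup (Fin d) ℂ) : ν {x | P (Φ x * g) = 0} = 0 := by
    have han : AnalyticOnNhd ℝ (fun x => P (Φ x * g)) Set.univ := fun x _ => by
      simp only [hp]
      refine MvPolynomial.analyticAt_eval_re_im
        (M := fun x l => (Φ x l : Matrix (Fin d) (Fin d) ℂ) * (g l : Matrix (Fin d) (Fin d) ℂ))
        (fun l i j => ?_) p
      simp only [mul_apply]
      exact Finset.analyticAt_fun_sum _ fun k _ =>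
        (analyticAt_cayleyUnitary_apply x l i k).mul analyticAt_const
    obtain ⟨x, hx⟩ := denseRange_cayleyUnitary.exists_mem_open
      (s := {w | P (w * g) ≠ 0}) (isOpen_ne_fun (by fun_prop) continuous_const)
      ⟨h * g⁻¹, by simpa using hh⟩
    exact han.measure_zeros_eq_zero ν hx
  have hmeas : MeasurableSet {q : (Fin m → Fin d → Fin d → ℂ) ×
      (Fin m → Matrix.unitaryGroup (Fin d) ℂ) | P (Φ q.1 * q.2) = 0} :=
    (isClosed_eq (by fun_prop) continuous_const).measurableSet
  have hprod : (ν.prod μ) {q : (Fin m → Fin d → Fin d → ℂ) ×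
      (Fin m → Matrix.unitaryGroup (Fin d) ℂ) | P (Φ q.1 * q.2) = 0} = 0 := by
    rw [Measure.prod_apply_symm hmeas]
    simpa using lintegral_eq_zero_of_ae_eq_zero (.of_forall hslice)
  obtain ⟨x, hx⟩ := (Measure.measure_ae_null_of_prod_null hprod).exists
  have htrans : μ ((Φ x * ·) ⁻¹' {Us | P Us = 0}) = 0 := hx
  rwa [measure_preimage_mul] at htrans

end
end

section
/- Let d ≥ 3 and let Ω⁻_d(0) be the d(d−1)/2 × d(d−1)/2 matrix indexed by P = {(m,n) : 1 ≤ m < n ≤ d} whose entry in row (m,n) and column (j,k) equals: 0 if (j,k) = (m,n); 1 if j = m and k ≠ n; −1 if k = m; 1 if k = n and j ≠ m; −1 if j = n; and 0 otherwise. Then the characteristic polynomial of Ω⁻_d(0) is (X − (d−2))^{d−1} · (X + 2)^{(d−1)(d−2)/2}; i.e., Ω⁻_d(0) has eigenvalue d−2 with algebraic multiplicity d−1 and eigenvalue −2 with algebraic multiplicity (d−1)(d−2)/2. -/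
open Matrix Polynomial

noncomputable section

/-- The index set `P = {(m,n) : 1 ≤ m < n ≤ d}`. -/
abbrev PairIdx (d : ℕ) := {p : Fin d × Fin d // p.1 < p.2}

/-- The matrix `Ω⁻_d(0)`, indexed by `P = {(m,n) : m < n}`: its entry in row `(m,n)` and
column `(j,k)` is `0` if `(j,k) = (m,n)`; `1` if `j = m` and `k ≠ n`; `−1` if `k = m`;
`1` if `k = n` and `j ≠ m`; `−1` if `j = n`; and `0` otherwise. -/
def OmegaMinus (d : ℕ) : Matrix (PairIdx d) (PairIdx d) ℂ :=
  Matrix.of fun r c =>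
    if c.1.1 = r.1.1 ∧ c.1.2 = r.1.2 then 0
    else if c.1.1 = r.1.1 ∧ c.1.2 ≠ r.1.2 then 1
    else if c.1.2 = r.1.1 then -1
    else if c.1.2 = r.1.2 ∧ c.1.1 ≠ r.1.1 then 1
    else if c.1.1 = r.1.2 then -1
    else 0

/-- The signed vertex-edge incidence matrix of the complete graph on `Fin d`, with the edge
`(m,n)`, `m < n`, oriented from `n` to `m`: row `(m,n)` is `eₘ − eₙ`. -/
def incidence (d : ℕ) : Matrix (PairIdx d) (Fin d) ℂ :=
  Matrix.of fun r i => (if r.1.1 = i then 1 else 0) - (if r.1.2 = i then 1 else 0)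

theorem card_pairIdx (d : ℕ) : Fintype.card (PairIdx d) = d.choose 2 := by
  rw [Fintype.card_subtype, Fintype.card_product_filter_lt, Fintype.card_fin]

/-- Twice the sum over increasing pairs of a symmetric function vanishing on the diagonal is its
sum over all pairs. -/
theorem two_mul_sum_pairIdx {R : Type*} [CommRing R] {d : ℕ} (f : Fin d → Fin d → R)
    (hsymm : ∀ p q, f p q = f q p) (hdiag : ∀ p, f p p = 0) :
    2 * ∑ x : PairIdx d, f x.1.1 x.1.2 = ∑ p, ∑ q, f p q := by
  have h : ∑ x : PairIdx d, f x.1.1 x.1.2 = ∑ p, ∑ q, if p < q then f p q else 0 := by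
    rw [← Fintype.sum_prod_type', ← Finset.sum_filter]
    exact (Finset.sum_subtype _ (by simp) fun x : Fin d × Fin d => f x.1 x.2).symm
  have h' : ∑ x : PairIdx d, f x.1.1 x.1.2 = ∑ p, ∑ q, if q < p then f p q else 0 := by
    rw [h, Finset.sum_comm]
    simp only [hsymm]
  rw [two_mul]
  nth_rewrite 1 [h]
  rw [h', ← Finset.sum_add_distrib]
  refine Finset.sum_congr rfl fun p _ => ?_
  rw [← Finset.sum_add_distrib]
  refine Finset.sum_congr rfl fun q _ => ?_
  rcases lt_trichotomy p q with hpq | rfl | hpq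
  · simp [hpq, hpq.not_gt]
  · simp [hdiag]
  · simp [hpq, hpq.not_gt]

theorem incidence_transpose_mul_incidence (d : ℕ) :
    (incidence d)ᵀ * incidence d =
      vecMulVec (fun _ => -1) (fun _ => 1) - scalar (Fin d) (-(d : ℂ)) := by
  ext i j
  have h := two_mul_sum_pairIdx (R := ℂ) (d := d)
    (fun p q => ((if p = i then 1 else 0) - (if q = i then 1 else 0)) *
      ((if p = j then 1 else 0) - (if q = j then 1 else 0)))
    (fun p q => by ring) (fun p => by simp)
  apply mul_left_cancel₀ (two_ne_zero (α := ℂ))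
  simp only [mul_apply, transpose_apply, incidence, of_apply]
  rw [h]
  simp only [sub_mul, mul_sub, Finset.sum_sub_distrib]
  by_cases hij : i = j
  · subst hij
    simp [vecMulVec_apply]
    ring
  · simp [vecMulVec_apply, hij, Ne.symm hij]
    ring

theorem charpoly_incidence_transpose_mul_incidence {d : ℕ} (hd : 1 ≤ d) :
    ((incidence d)ᵀ * incidence d).charpoly = X * (X - C (d : ℂ)) ^ (d - 1) := by
  obtain ⟨e, rfl⟩ := Nat.exists_eq_add_of_le' hd
  rw [incidence_transpose_mul_incidence, charpoly_sub_scalar, charpoly_vecMulVec]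
  simp [dotProduct, smul_eq_C_mul, pow_succ]
  ring

theorem OmegaMinus_eq (d : ℕ) :
    OmegaMinus d = incidence d * (incidence d)ᵀ - scalar (PairIdx d) 2 := by
  ext ⟨⟨m, n⟩, hmn⟩ ⟨⟨j, k⟩, hjk⟩
  simp only [OmegaMinus, incidence, of_apply, Matrix.sub_apply, mul_apply, transpose_apply,
    mul_sub, Finset.sum_sub_distrib, scalar_apply, diagonal_apply, Subtype.mk.injEq,
    Prod.mk.injEq, mul_ite, mul_one, mul_zero, Finset.sum_ite_eq, Finset.mem_univ, if_true]
  dsimp only at hmn hjk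
  split_ifs <;> first | (norm_num; done) | (exfalso; omega)

theorem choose_two_sub_add_one {d : ℕ} (hd : 3 ≤ d) :
    d ≤ d.choose 2 ∧ d.choose 2 - d + 1 = (d - 1) * (d - 2) / 2 := by
  obtain ⟨e, rfl⟩ := Nat.exists_eq_add_of_le' hd
  have h1 : (e + 3).choose 2 = (e + 2).choose 2 + (e + 2) := by
    rw [Nat.choose_succ_succ' (e + 2) 1, Nat.choose_one_right, add_comm]
  have h2 : (e + 2).choose 2 = (e + 2) * (e + 1) / 2 := Nat.choose_two_right _
  have h3 : 0 < (e + 2).choose 2 := Nat.choose_pos (by omega)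
  simp only [Nat.reduceSubDiff, Nat.add_one_sub_one] at *
  omega

/-- For `d ≥ 3`, the characteristic polynomial of `Ω⁻_d(0)` is
`(X − (d−2))^{d−1} (X + 2)^{(d−1)(d−2)/2}`. -/
theorem charpoly_OmegaMinus (d : ℕ) (hd : 3 ≤ d) :
    (OmegaMinus d).charpoly =
      (X - C ((d : ℂ) - 2)) ^ (d - 1) * (X + C 2) ^ ((d - 1) * (d - 2) / 2) := by
  obtain ⟨hle, hexp⟩ := choose_two_sub_add_one hd
  rw [OmegaMinus_eq, charpoly_sub_scalar, charpoly_mul_comm_of_le _ _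
    (by simpa only [card_pairIdx, Fintype.card_fin] using hle),
    charpoly_incidence_transpose_mul_incidence (by omega), card_pairIdx, Fintype.card_fin,
    ← mul_assoc, ← pow_succ, hexp, mul_comm]
  simp only [mul_comp, pow_comp, sub_comp, X_comp, C_comp, C_sub]
  congr 2
  ring

end
end
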